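/- Let D be a 6-angulation of the (4s+2)-gon and T_D its associated triangulation. For every vertex α with 0 ≤ α ≤ 4s+1, the number t_α of triangles of T_D incident with α satisfies t_α = q_α if α is even and t_α = 3q_α if α is odd, where q_α is the number of hexagons of D incident with α. -/

import Mathlib

namespace FriezeNote

/-- `x` lies strictly between `a` and `b`, going in the positive direction
around the vertices `0, 1, …, m-1` of the `m`-gon. -/
def StrictBtw (m : ℕ) (a x b : ZMod m) : Prop :=
  0 < (x - a).val ∧ (x - a).val < (b - a).val

/-- Two chords of the `m`-gon cross (in the interior of the polygon). -/
def Crosses (m : ℕ) (e f : Sym2 (ZMod m)) : Prop :=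
  ∃ a b c d : ZMod m, e = s(a, b) ∧ f = s(c, d) ∧
    StrictBtw m a c b ∧ StrictBtw m b d a

/-- `e` is a diagonal of the `m`-gon: its endpoints are distinct and non-adjacent. -/
def IsDiagonal (m : ℕ) (e : Sym2 (ZMod m)) : Prop :=
  ∃ a b : ZMod m, e = s(a, b) ∧ a ≠ b ∧ b ≠ a + 1 ∧ a ≠ b + 1

/-- `e` is a boundary edge of the `m`-gon. -/
def IsPolyEdge (m : ℕ) (e : Sym2 (ZMod m)) : Prop :=
  ∃ a : ZMod m, e = s(a, a + 1)

/-- A dissection of the `m`-gon: a set of pairwise non-crossing diagonals. -/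
def IsDissection (m : ℕ) (D : Set (Sym2 (ZMod m))) : Prop :=
  (∀ e ∈ D, IsDiagonal m e) ∧ ∀ e ∈ D, ∀ f ∈ D, ¬ Crosses m e f

/-- `b` is the cyclic successor of `a` among the vertices of the finite set `C`:
both lie in `C` and no element of `C` lies strictly between them. -/
def CycConsec (m : ℕ) (C : Finset (ZMod m)) (a b : ZMod m) : Prop :=
  a ∈ C ∧ b ∈ C ∧ a ≠ b ∧ ∀ x ∈ C, ¬ StrictBtw m a x b

/-- `C` is the vertex set of one of the subpolygons (cells) into which the
dissection `D` splits the `m`-gon: it has at least `3` vertices, cyclically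
consecutive vertices of `C` are joined by a diagonal of `D` or a boundary edge,
and any diagonal of `D` with both endpoints in `C` joins cyclically consecutive
vertices of `C`. -/
def IsCell (m : ℕ) (D : Set (Sym2 (ZMod m))) (C : Finset (ZMod m)) : Prop :=
  3 ≤ C.card ∧
  (∀ a b : ZMod m, CycConsec m C a b → (s(a, b) ∈ D ∨ IsPolyEdge m s(a, b))) ∧
  (∀ a b : ZMod m, a ∈ C → b ∈ C → s(a, b) ∈ D →
    (CycConsec m C a b ∨ CycConsec m C b a))

/-- `D` is a `p`-angulation of the `m`-gon: a dissection all of whose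
subpolygons are `p`-gons. -/
def IsPAngulation (m p : ℕ) (D : Set (Sym2 (ZMod m))) : Prop :=
  IsDissection m D ∧ ∀ C : Finset (ZMod m), IsCell m D C → C.card = p

/-- The number of subpolygons of the dissection `D` incident with the vertex `α`. -/
noncomputable def cellCount (m : ℕ) (D : Set (Sym2 (ZMod m))) (α : ZMod m) : ℕ :=
  {C : Finset (ZMod m) | IsCell m D C ∧ α ∈ C}.ncard

/-- A frieze pattern of width `n`: rows numbered `0, …, n + 3` from below (entries
of rows beyond `n + 3` are irrelevant), each row indexed by `ℤ`, rows `0` and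
`n + 3` are zeroes, rows `1` and `n + 2` are ones, rows `2` through `n + 1` are
positive, and every diamond `b` (top), `a` (left), `d` (right), `c` (bottom)
satisfies `a * d - b * c = 1`. -/
structure Frieze (n : ℕ) where
  entry : ℕ → ℤ → ℝ
  nonneg : ∀ i k, i ≤ n + 3 → 0 ≤ entry i k
  row_zero : ∀ k, entry 0 k = 0
  row_top : ∀ k, entry (n + 3) k = 0
  row_one : ∀ k, entry 1 k = 1
  row_penult : ∀ k, entry (n + 2) k = 1
  row_pos : ∀ i k, 2 ≤ i → i ≤ n + 1 → 0 < entry i k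
  diamond : ∀ i k, 1 ≤ i → i ≤ n + 2 →
    entry i k * entry i (k + 1) - entry (i + 1) k * entry (i - 1) (k + 1) = 1

/-- `λ_p = 2 cos (π / p)`. -/
noncomputable def lambda (p : ℕ) : ℝ := 2 * Real.cos (Real.pi / p)

/-- A frieze pattern is of type `Λ_p` if every entry of its quiddity row (row `2`)
is a positive integral multiple of `λ_p`. -/
def IsTypeLambda (p : ℕ) {n : ℕ} (F : Frieze n) : Prop :=
  ∀ k : ℤ, ∃ q : ℕ, 0 < q ∧ F.entry 2 k = (q : ℝ) * lambda p

/-- `F` is the frieze of type `Λ_p` associated to the `p`-angulation `D` of the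
`m`-gon: its quiddity row is the periodic sequence `(λ_p q_0, …, λ_p q_{m-1})`. -/
def FriezeOfPAng (p m : ℕ) {n : ℕ} (F : Frieze n) (D : Set (Sym2 (ZMod m))) : Prop :=
  ∀ k : ℤ, F.entry 2 k = lambda p * (cellCount m D (k : ZMod m) : ℝ)

/-- `F` is the Conway–Coxeter frieze of the triangulation `T` of the `m`-gon:
its quiddity row is the periodic sequence `(t_0, …, t_{m-1})` where `t_α` is the
number of triangles of `T` incident with the vertex `α`. -/
def CCFrieze (m : ℕ) {n : ℕ} (F : Frieze n) (T : Set (Sym2 (ZMod m))) : Prop :=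
  ∀ k : ℤ, F.entry 2 k = (cellCount m T (k : ZMod m) : ℝ)

/-- A vertex of the `m`-gon is black when its label is odd (vertices are coloured
alternately, odd vertices black and even vertices white). -/
def IsBlack (m : ℕ) (a : ZMod m) : Prop := a.val % 2 = 1

/-- The set of chords joining two distinct black (odd) vertices of a common
subpolygon of the dissection `D`. -/
def oddPairs (m : ℕ) (D : Set (Sym2 (ZMod m))) : Set (Sym2 (ZMod m)) :=
  {e | ∃ (C : Finset (ZMod m)) (a b : ZMod m),
    IsCell m D C ∧ e = s(a, b) ∧ a ∈ C ∧ b ∈ C ∧ a ≠ b ∧ IsBlack m a ∧ IsBlack m b}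

/-- The triangulation associated to a dissection `D`: the diagonals of `D`
together with, inside each subpolygon, the chords joining pairs of its odd
(black) vertices. -/
def assocTriangulation (m : ℕ) (D : Set (Sym2 (ZMod m))) : Set (Sym2 (ZMod m)) :=
  D ∪ oddPairs m D

/-- `E` is a noncrossing tree on the black (odd) vertices of the `m`-gon:
its edges join distinct black vertices, are pairwise non-crossing, any two black
vertices are connected by a sequence of edges, and there is no loop of edges. -/
def IsNoncrossingTree (m : ℕ) (E : Set (Sym2 (ZMod m))) : Prop :=
  (∀ e ∈ E, ∃ a b : ZMod m, e = s(a, b) ∧ a ≠ b ∧ IsBlack m a ∧ IsBlack m b) ∧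
  (∀ e ∈ E, ∀ f ∈ E, ¬ Crosses m e f) ∧
  (∀ a b : ZMod m, IsBlack m a → IsBlack m b →
    (SimpleGraph.fromEdgeSet E).Reachable a b) ∧
  (SimpleGraph.fromEdgeSet E).IsAcyclic

/-- The inverse of the tree-of-quadrangulation map: it sends a noncrossing tree
`E` to the set of all black–white diagonals crossing no edge of `E`. -/
def quadOfTree (m : ℕ) (E : Set (Sym2 (ZMod m))) : Set (Sym2 (ZMod m)) :=
  {e | IsDiagonal m e ∧
    (∃ a b : ZMod m, e = s(a, b) ∧ IsBlack m a ∧ ¬ IsBlack m b) ∧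
    ∀ f ∈ E, ¬ Crosses m e f}

/-- `e` is a diagonal of the subpolygon with vertex set `C`: both endpoints are
distinct vertices of `C` which are not cyclically consecutive in `C`. -/
def CellDiagonal (m : ℕ) (C : Finset (ZMod m)) (e : Sym2 (ZMod m)) : Prop :=
  ∃ a b : ZMod m, e = s(a, b) ∧ a ∈ C ∧ b ∈ C ∧ a ≠ b ∧
    ¬ CycConsec m C a b ∧ ¬ CycConsec m C b a

/-- `e` is an edge of the subpolygon with vertex set `C`: it joins two
cyclically consecutive vertices of `C`. -/
def CellEdge (m : ℕ) (C : Finset (ZMod m)) (e : Sym2 (ZMod m)) : Prop :=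
  ∃ a b : ZMod m, e = s(a, b) ∧ (CycConsec m C a b ∨ CycConsec m C b a)

/-- `C` is an ear of the dissection `D`: a subpolygon all of whose edges except
exactly one are boundary edges of the polygon. -/
def IsEar (m : ℕ) (D : Set (Sym2 (ZMod m))) (C : Finset (ZMod m)) : Prop :=
  IsCell m D C ∧ ∃! e : Sym2 (ZMod m), CellEdge m C e ∧ ¬ IsPolyEdge m e

/-- The dual graph of a dissection `D`: vertices are the subpolygons of `D`, and
two subpolygons are adjacent when they share a common edge (a diagonal of `D`). -/
def dualGraph (m : ℕ) (D : Set (Sym2 (ZMod m))) :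
    SimpleGraph {C : Finset (ZMod m) // IsCell m D C} :=
  SimpleGraph.fromRel fun C C' =>
    ∃ e ∈ D, ∃ a b : ZMod m, e = s(a, b) ∧
      a ∈ C.1 ∧ b ∈ C.1 ∧ a ∈ C'.1 ∧ b ∈ C'.1


section helpers

variable {m : ℕ} [NeZero m]

lemma vsub (x y : ZMod m) :
    (x - y).val = if y.val ≤ x.val then x.val - y.val else x.val + m - y.val := by
  have hx := ZMod.val_lt x
  have hy := ZMod.val_lt y
  split_ifs with h
  · exact ZMod.val_sub h
  · have h1 : (y - x).val = y.val - x.val := ZMod.val_sub (by omega)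
    have h2 : x - y = -(y - x) := by ring
    have h3 : y - x ≠ 0 := by
      intro h0
      rw [h0, ZMod.val_zero] at h1
      omega
    have : NeZero (y - x) := ⟨h3⟩
    rw [h2, ZMod.val_neg_of_ne_zero, h1]
    omega

lemma sb_val (x z y : ZMod m) : StrictBtw m x z y ↔
    (x.val < z.val ∧ z.val < y.val) ∨ (z.val < y.val ∧ y.val < x.val) ∨
      (y.val < x.val ∧ x.val < z.val) := by
  unfold StrictBtw
  rw [vsub, vsub]
  have hx := ZMod.val_lt x
  have hy := ZMod.val_lt y
  have hz := ZMod.val_lt z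
  split_ifs <;> omega

lemma sb_base (a x z y : ZMod m) : StrictBtw m x z y ↔
    ((x - a).val < (z - a).val ∧ (z - a).val < (y - a).val) ∨
    ((z - a).val < (y - a).val ∧ (y - a).val < (x - a).val) ∨
      ((y - a).val < (x - a).val ∧ (x - a).val < (z - a).val) := by
  rw [← sb_val]
  unfold StrictBtw
  simp

lemma pinj {a x y : ZMod m} (h : (x - a).val = (y - a).val) : x = y := by
  have := ZMod.val_injective m h
  simpa using this

lemma vinj {x y : ZMod m} (h : x.val = y.val) : x = y := ZMod.val_injective m h

lemma vne {x y : ZMod m} (h : x ≠ y) : x.val ≠ y.val := fun h' => h (vinj h')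

lemma diag_ne {a b : ZMod m} (h : IsDiagonal m s(a, b)) :
    a ≠ b ∧ b ≠ a + 1 ∧ a ≠ b + 1 := by
  obtain ⟨c, d, he, h1, h2, h3⟩ := h
  rw [Sym2.eq_iff] at he
  rcases he with ⟨rfl, rfl⟩ | ⟨rfl, rfl⟩
  · exact ⟨h1, h2, h3⟩
  · exact ⟨h1.symm, h3, h2⟩

lemma edge_cases {a b : ZMod m} (h : IsPolyEdge m s(a, b)) : b = a + 1 ∨ a = b + 1 := by
  obtain ⟨c, he⟩ := h
  rw [Sym2.eq_iff] at he
  rcases he with ⟨rfl, rfl⟩ | ⟨rfl, rfl⟩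
  · exact Or.inl rfl
  · exact Or.inr rfl

lemma one_val (hm : 3 ≤ m) (a : ZMod m) : (a + 1 - a).val = 1 := by
  have : Fact (1 < m) := ⟨by omega⟩
  have : a + 1 - a = 1 := by ring
  rw [this, ZMod.val_one]

lemma one_val' (hm : 3 ≤ m) (a : ZMod m) : (a - (a + 1)).val = m - 1 := by
  have h1 := one_val hm a
  rw [vsub] at h1 ⊢
  have hx := ZMod.val_lt a
  have hy := ZMod.val_lt (a+1)
  split_ifs at * <;> omega

lemma no_cross {D : Set (Sym2 (ZMod m))} (hD : IsDissection m D) {a b c d : ZMod m}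
    (h1 : s(a, b) ∈ D) (h2 : s(c, d) ∈ D) (h3 : StrictBtw m a c b) (h4 : StrictBtw m b d a) :
    False := hD.2 _ h1 _ h2 ⟨a, b, c, d, rfl, rfl, h3, h4⟩

/-- gap around a vertex outside `C` -/
lemma gap_exists {C : Finset (ZMod m)} (hC : 2 ≤ C.card) {x : ZMod m} (hx : x ∉ C) :
    ∃ u v, CycConsec m C u v ∧ StrictBtw m u x v := by
  have hne : C.Nonempty := Finset.card_pos.1 (by omega)
  obtain ⟨v, hv, hvm⟩ := Finset.exists_min_image C (fun y => (y - x).val) hne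
  obtain ⟨u, hu, hum⟩ := Finset.exists_max_image C (fun y => (y - x).val) hne
  have h0 : (x - x).val = 0 := by simp
  have hv0 : (v - x).val ≠ (x - x).val := fun h => hx (pinj h ▸ hv)
  have huv : u ≠ v := by
    rintro rfl
    obtain ⟨p, hp, q, hq, hpq⟩ := Finset.one_lt_card.1 (show 1 < C.card by omega)
    have := hvm p hp
    have := hvm q hq
    have := hum p hp
    have := hum q hq
    exact hpq (pinj (a := x) (by omega))
  have h3 : (u - x).val ≠ (v - x).val := fun h => huv (pinj h)
  have h4 := hvm u hu
  refine ⟨u, v, ⟨hu, hv, huv, fun z hz hs => ?_⟩, ?_⟩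
  · rw [sb_base x] at hs
    have := hvm z hz
    have := hum z hz
    omega
  · rw [sb_base x]
    omega

lemma succ_exists {C : Finset (ZMod m)} (hC : 2 ≤ C.card) {x : ZMod m} (hx : x ∈ C) :
    ∃ v, CycConsec m C x v := by
  have hne : (C.erase x).Nonempty := Finset.card_pos.1 (by rw [Finset.card_erase_of_mem hx]; omega)
  obtain ⟨v, hv, hvm⟩ := Finset.exists_min_image (C.erase x) (fun y => (y - x).val) hne
  rw [Finset.mem_erase] at hv
  refine ⟨v, hx, hv.2, hv.1.symm, fun z hz hs => ?_⟩
  unfold StrictBtw at hs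
  have hzx : z ≠ x := by
    rintro rfl
    simp at hs
  have := hvm z (Finset.mem_erase.2 ⟨hzx, hz⟩)
  omega

lemma succ_unique {C : Finset (ZMod m)} {x u v : ZMod m} (h1 : CycConsec m C x u)
    (h2 : CycConsec m C x v) : u = v := by
  by_contra h
  have a1 := h1.2.2.2 v h2.2.1
  have a2 := h2.2.2.2 u h1.2.1
  have := vne h
  have := vne h1.2.2.1
  have := vne h2.2.2.1
  rw [sb_val] at a1 a2
  omega

lemma third {C : Finset (ZMod m)} (hC : 3 ≤ C.card) (a b : ZMod m) :
    ∃ z ∈ C, z ≠ a ∧ z ≠ b := by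
  obtain ⟨z, hz, hz'⟩ := Finset.exists_mem_notMem_of_card_lt_card
    (s := {a, b}) (t := C) (lt_of_le_of_lt Finset.card_le_two (by omega))
  simp at hz'
  exact ⟨z, hz, hz'.1, hz'.2⟩

/-- a vertex in a gap of a cell forces the gap edge to be a diagonal -/
lemma gap_mem (hm : 3 ≤ m) {D : Set (Sym2 (ZMod m))} {C : Finset (ZMod m)} (hC : IsCell m D C)
    {u v x : ZMod m} (h : CycConsec m C u v) (hx : StrictBtw m u x v) : s(u, v) ∈ D := by
  rcases hC.2.1 u v h with h' | h'
  · exact h'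
  · exfalso
    rcases edge_cases h' with rfl | rfl
    · have := one_val hm u
      unfold StrictBtw at hx
      omega
    · obtain ⟨z, hz, hz1, hz2⟩ := third hC.1 (v+1) v
      have h1 := h.2.2.2 z hz
      have h2 := one_val hm v
      have h3 := vne hz1
      have h4 := vne hz2
      have h5 := vne h.2.2.1
      have h6 : StrictBtw m v z (v+1) := by
        rw [sb_val] at h1 ⊢
        omega
      unfold StrictBtw at h6
      omega

lemma diag_cell_nocross_aux (hm : 3 ≤ m) {D : Set (Sym2 (ZMod m))} (hD : IsDissection m D)
    {C : Finset (ZMod m)} (hC : IsCell m D C) {a b c d : ZMod m} (hab : s(a, b) ∈ D)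
    (hc : c ∈ C) (hd : d ∈ C) (h1 : StrictBtw m a c b) (h2 : StrictBtw m b d a) : a ∈ C := by
  by_contra ha
  obtain ⟨u, v, huv, hx⟩ := gap_exists (by have := hC.1; omega) ha
  have hD' := gap_mem hm hC huv hx
  have k1 := huv.2.2.2 c hc
  have k2 := huv.2.2.2 d hd
  have k3 : ¬ StrictBtw m v b u := fun h => no_cross hD hD' hab hx h
  rw [sb_val] at *
  omega

lemma diag_cell_nocross (hm : 3 ≤ m) {D : Set (Sym2 (ZMod m))} (hD : IsDissection m D)
    {C : Finset (ZMod m)} (hC : IsCell m D C) {a b c d : ZMod m} (hab : s(a, b) ∈ D)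
    (hc : c ∈ C) (hd : d ∈ C) (h1 : StrictBtw m a c b) (h2 : StrictBtw m b d a) : False := by
  have ha := diag_cell_nocross_aux hm hD hC hab hc hd h1 h2
  have hb := diag_cell_nocross_aux hm hD hC (Sym2.eq_swap ▸ hab) hd hc h2 h1
  rcases hC.2.2 a b ha hb hab with h | h
  · exact h.2.2.2 c hc h1
  · exact h.2.2.2 d hd h2

lemma cell_subset_eq (hm : 3 ≤ m) {D : Set (Sym2 (ZMod m))}
    {C C' : Finset (ZMod m)} (hC : IsCell m D C) (hC' : IsCell m D C') (hs : C' ⊆ C) : C' = C := by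
  refine Finset.Subset.antisymm hs fun x hx => ?_
  by_contra hx'
  obtain ⟨u, v, huv, hb⟩ := gap_exists (by have := hC'.1; omega) hx'
  have hD' := gap_mem hm hC' huv hb
  obtain ⟨z, hz, hz1, hz2⟩ := third hC'.1 u v
  rcases hC.2.2 u v (hs huv.1) (hs huv.2.1) hD' with h | h
  · exact h.2.2.2 x hx hb
  · have h1 := h.2.2.2 z (hs hz)
    have h2 := huv.2.2.2 z hz
    have h3 := vne hz1
    have h4 := vne hz2
    have h5 := vne huv.2.2.1
    rw [sb_val] at *
    omega

lemma cells_sep (hm : 3 ≤ m) {D : Set (Sym2 (ZMod m))} (hD : IsDissection m D)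
    {C C' : Finset (ZMod m)} (hC : IsCell m D C) (hC' : IsCell m D C') (hne : C' ≠ C) :
    ∃ u v, CycConsec m C u v ∧ s(u, v) ∈ D ∧ ∀ y ∈ C', ¬ StrictBtw m v y u := by
  have : ¬ C' ⊆ C := fun h => hne (cell_subset_eq hm hC hC' h)
  obtain ⟨x, hx, hx'⟩ := Finset.not_subset.1 this
  obtain ⟨u, v, huv, hb⟩ := gap_exists (by have := hC.1; omega) hx'
  have hD' := gap_mem hm hC huv hb
  exact ⟨u, v, huv, hD', fun y hy hs => diag_cell_nocross hm hD hC' hD' hx hy hb hs⟩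

lemma cell_unique (hm : 3 ≤ m) {D : Set (Sym2 (ZMod m))} (hD : IsDissection m D)
    {C C' : Finset (ZMod m)} (hC : IsCell m D C) (hC' : IsCell m D C') {a b : ZMod m}
    (h : CycConsec m C a b) (h' : CycConsec m C' a b) : C' = C := by
  by_contra hne
  obtain ⟨u, v, huv, -, hy⟩ := cells_sep hm hD hC hC' hne
  obtain ⟨z, hz, hz1, hz2⟩ := third hC.1 a b
  obtain ⟨w, hw, hw1, hw2⟩ := third hC'.1 a b
  have a1 := hy a h'.1
  have a2 := hy b h'.2.1
  have a3 := hy w hw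
  have b1 := huv.2.2.2 a h.1
  have b2 := huv.2.2.2 b h.2.1
  have b3 := huv.2.2.2 z hz
  have c1 := h.2.2.2 z hz
  have c2 := h'.2.2.2 w hw
  have := vne h.2.2.1
  have := vne huv.2.2.1
  have := vne hz1
  have := vne hz2
  have := vne hw1
  have := vne hw2
  rw [sb_val] at *
  omega

lemma cells_nocross (hm : 3 ≤ m) {D : Set (Sym2 (ZMod m))} (hD : IsDissection m D)
    {C C' : Finset (ZMod m)} (hC : IsCell m D C) (hC' : IsCell m D C') (hne : C' ≠ C)
    {a b c d : ZMod m} (ha : a ∈ C) (hb : b ∈ C) (hc : c ∈ C') (hd : d ∈ C')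
    (h1 : StrictBtw m a c b) (h2 : StrictBtw m b d a) : False := by
  obtain ⟨u, v, huv, -, hy⟩ := cells_sep hm hD hC hC' hne
  have a1 := hy c hc
  have a2 := hy d hd
  have b1 := huv.2.2.2 a ha
  have b2 := huv.2.2.2 b hb
  have := vne huv.2.2.1
  rw [sb_val] at *
  omega

/-- two distinct vertices common to two distinct cells are joined by a diagonal -/
lemma cells_share (hm : 3 ≤ m) {D : Set (Sym2 (ZMod m))} (hD : IsDissection m D)
    {C C' : Finset (ZMod m)} (hC : IsCell m D C) (hC' : IsCell m D C') (hne : C' ≠ C)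
    {a b : ZMod m} (ha : a ∈ C) (hb : b ∈ C) (ha' : a ∈ C') (hb' : b ∈ C') (hab : a ≠ b) :
    s(a, b) ∈ D := by
  obtain ⟨u, v, huv, hd, hy⟩ := cells_sep hm hD hC hC' hne
  have a1 := hy a ha'
  have a2 := hy b hb'
  have b1 := huv.2.2.2 a ha
  have b2 := huv.2.2.2 b hb
  have h1 := vne huv.2.2.1
  have h2 := vne hab
  rw [sb_val] at *
  have : (a.val = u.val ∧ b.val = v.val) ∨ (a.val = v.val ∧ b.val = u.val) := by omega
  rcases this with ⟨h3, h4⟩ | ⟨h3, h4⟩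
  · rw [vinj h3, vinj h4]; exact hd
  · rw [vinj h3, vinj h4, Sym2.eq_swap]; exact hd

lemma step_val (hm : 3 ≤ m) {x b : ZMod m} (h : (x - b).val + 1 < m) :
    (x + 1 - b).val = (x - b).val + 1 := by
  have : x + 1 - b = (x - b) + 1 := by ring
  rw [this]
  have : Fact (1 < m) := ⟨by omega⟩
  rw [ZMod.val_add_of_lt, ZMod.val_one]
  rw [ZMod.val_one]; omega

lemma cell_exists (hm : 3 ≤ m) {D : Set (Sym2 (ZMod m))} (hD : IsDissection m D)
    {a b : ZMod m} (h : s(a, b) ∈ D ∨ b = a + 1) :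
    ∃ C, IsCell m D C ∧ CycConsec m C a b := by
  classical
  have hb0 : (b - b).val = 0 := by simp
  have hN : 2 ≤ (a - b).val := by
    rcases h with h | rfl
    · obtain ⟨h1, h2, h3⟩ := diag_ne (hD.1 _ h)
      have e1 : (a - b).val ≠ (b - b).val := fun e => h1 (pinj e)
      have e2 : (a - b).val ≠ (b + 1 - b).val := fun e => h3 (pinj e)
      rw [one_val hm] at e2
      omega
    · rw [one_val' hm]; omega
  have hab : a ≠ b := by
    rintro rfl
    omega
  have hedge : s(a, b) ∈ D ∨ IsPolyEdge m s(a, b) := by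
    rcases h with h | rfl
    · exact Or.inl h
    · exact Or.inr ⟨a, rfl⟩
  let Cov : ZMod m → Prop := fun x => ∃ c d, s(c, d) ∈ D ∧ (c - b).val < (x - b).val ∧
    (x - b).val < (d - b).val ∧ (d - b).val ≤ (a - b).val ∧ ¬ (c = b ∧ d = a)
  let C : Finset (ZMod m) := Finset.univ.filter fun x => (x - b).val ≤ (a - b).val ∧ ¬ Cov x
  have hC : ∀ x, x ∈ C ↔ (x - b).val ≤ (a - b).val ∧ ¬ Cov x := fun x => by simp [C]
  have hbC : b ∈ C := by
    rw [hC]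
    refine ⟨by omega, ?_⟩
    rintro ⟨c, d, h1, h2, -⟩
    omega
  have haC : a ∈ C := by
    rw [hC]
    refine ⟨le_rfl, ?_⟩
    rintro ⟨c, d, h1, h2, h3, h4, -⟩
    omega
  have hnext : ∀ x ∈ C, (x - b).val < (a - b).val → ∃ y ∈ C, (x - b).val < (y - b).val ∧
      ¬ (x = b ∧ y = a) ∧ (s(x, y) ∈ D ∨ (y - b).val = (x - b).val + 1) := by
    intro x hx hxa
    let S : Finset (ZMod m) := Finset.univ.filter fun y => (x - b).val < (y - b).val ∧
      (y - b).val ≤ (a - b).val ∧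
      ¬ (x = b ∧ y = a) ∧ (s(x, y) ∈ D ∨ (y - b).val = (x - b).val + 1)
    have hS : ∀ y, y ∈ S ↔ (x - b).val < (y - b).val ∧ (y - b).val ≤ (a - b).val ∧
      ¬ (x = b ∧ y = a) ∧ (s(x, y) ∈ D ∨ (y - b).val = (x - b).val + 1) := fun y => by simp [S]
    have hSne : S.Nonempty := by
      have hl := ZMod.val_lt (a - b)
      have e := step_val hm (x := x) (b := b) (by omega)
      refine ⟨x + 1, (hS _).2 ⟨by omega, by omega, ?_, Or.inr e⟩⟩
      rintro ⟨rfl, h2⟩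
      rw [h2] at e
      omega
    obtain ⟨y, hy, hmax⟩ := Finset.exists_max_image S (fun y => (y - b).val) hSne
    rw [hS] at hy
    obtain ⟨y1, y2, y3, y4⟩ := hy
    refine ⟨y, (hC _).2 ⟨y2, ?_⟩, y1, y3, y4⟩
    rintro ⟨c, d, h1, h2, h3, h4, h5⟩
    rcases lt_trichotomy (c - b).val (x - b).val with hlt | heq | hgt
    · exact ((hC _).1 hx).2 ⟨c, d, h1, hlt, by omega, h4, h5⟩
    · obtain rfl := pinj heq
      have := hmax d ((hS _).2 ⟨by omega, h4, h5, Or.inl h1⟩)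
      omega
    · rcases y4 with y4 | y4
      · refine no_cross hD y4 h1 ?_ ?_
        · rw [sb_base b]; omega
        · rw [sb_base b]; omega
      · omega
  have habC : CycConsec m C a b := by
    refine ⟨haC, hbC, hab, fun x hx hs => ?_⟩
    have := ((hC _).1 hx).1
    rw [sb_base b] at hs
    omega
  have key : ∀ x y, x ∈ C → y ∈ C → s(x, y) ∈ D → (x - b).val < (y - b).val →
      CycConsec m C x y ∨ CycConsec m C y x := by
    intro x y hx hy hd hlt
    by_cases hxy : x = b ∧ y = a
    · obtain ⟨rfl, rfl⟩ := hxy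
      exact Or.inr habC
    · left
      refine ⟨hx, hy, by rintro rfl; omega, fun z hz hs => ?_⟩
      have hy' := ((hC _).1 hy).1
      rw [sb_base b] at hs
      have hz' := ((hC _).1 hz)
      have hbz : ¬ ((z - b).val < (y - b).val ∧ (y - b).val < (x - b).val) := by omega
      exact hz'.2 ⟨x, y, hd, by omega, by omega, hy', hxy⟩
  refine ⟨C, ⟨?_, ?_, ?_⟩, habC⟩
  · obtain ⟨y, hy, h1, h2, -⟩ := hnext b hbC (by omega)
    have hyb : y ≠ b := by rintro rfl; omega
    have hya : y ≠ a := fun e => h2 ⟨rfl, e⟩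
    have : ({a, b, y} : Finset (ZMod m)) ⊆ C := by
      intro z hz
      simp at hz
      rcases hz with rfl | rfl | rfl <;> assumption
    have h3 : ({a, b, y} : Finset (ZMod m)).card = 3 :=
      Finset.card_eq_three.2 ⟨a, b, y, hab, hya.symm, hyb.symm, rfl⟩
    rw [← h3]
    exact Finset.card_le_card this
  · rintro x y ⟨hx, hy, hxy, hb⟩
    have hx' := ((hC _).1 hx).1
    have hy' := ((hC _).1 hy).1
    have hpne : (x - b).val ≠ (y - b).val := fun e => hxy (pinj e)
    rcases lt_or_gt_of_ne hpne with hlt | hgt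
    · obtain ⟨z, hz, h1, h2, h3⟩ := hnext x hx (by omega)
      have h4 := hb z hz
      rw [sb_base b] at h4
      have hz' := ((hC _).1 hz).1
      by_cases hzy : z = y
      · subst hzy
        rcases h3 with h3 | h3
        · exact Or.inl h3
        · right
          refine ⟨x, ?_⟩
          have hl := ZMod.val_lt (z - b)
          have e := step_val hm (x := x) (b := b) (by omega)
          rw [pinj (h3.trans e.symm)]
      · have hzy' : (z - b).val ≠ (y - b).val := fun e => hzy (pinj e)
        exfalso
        rcases h3 with h3 | h3
        · exact ((hC _).1 hy).2 ⟨x, z, h3, hlt, by omega, hz', h2⟩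
        · omega
    · have h1 := hb a haC
      have h2 := hb b hbC
      rw [sb_base b] at h1 h2
      have e1 : (x - b).val = (a - b).val := by omega
      have e2 : (y - b).val = (b - b).val := by omega
      rw [pinj e1, pinj e2]
      exact hedge
  · intro x y hx hy hd
    have hxy : x ≠ y := (diag_ne (hD.1 _ hd)).1
    have hpne : (x - b).val ≠ (y - b).val := fun e => hxy (pinj e)
    rcases lt_or_gt_of_ne hpne with hlt | hgt
    · exact key x y hx hy hd hlt
    · exact (key y x hy hx (Sym2.eq_swap ▸ hd) hgt).symm

lemma count_eq (hm : 3 ≤ m) {D : Set (Sym2 (ZMod m))} (hD : IsDissection m D) (α : ZMod m) :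
    cellCount m D α = {b | s(α, b) ∈ D}.ncard + 1 := by
  classical
  have hnot : α + 1 ∉ {b | s(α, b) ∈ D} := fun h => (diag_ne (hD.1 _ h)).2.1 rfl
  rw [← Set.ncard_insert_of_notMem hnot (Set.toFinite _)]
  have hex : ∀ b ∈ insert (α + 1) {b | s(α, b) ∈ D}, ∃ C, IsCell m D C ∧ CycConsec m C α b := by
    intro b hb
    apply cell_exists hm hD
    rcases hb with rfl | hb
    · exact Or.inr rfl
    · exact Or.inl hb
  choose g hg using hex
  symm
  unfold cellCount
  refine Set.ncard_congr g ?_ ?_ ?_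
  · intro b hb
    exact ⟨(hg b hb).1, (hg b hb).2.1⟩
  · intro b b' hb hb' h
    have h1 := (hg b hb).2
    have h2 := (hg b' hb').2
    rw [h] at h1
    exact succ_unique h1 h2
  · rintro C ⟨hC, hα⟩
    obtain ⟨b, hb⟩ := succ_exists (by have := hC.1; omega) hα
    have hmem : b ∈ insert (α + 1) {b | s(α, b) ∈ D} := by
      by_cases h1 : b = α + 1
      · exact Or.inl h1
      · right
        rcases hC.2.1 _ _ hb with h | h
        · exact h
        · rcases edge_cases h with h | h
          · exact absurd h h1
          · refine gap_mem hm hC hb (x := α + 1) ?_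
            have e1 := one_val hm α
            have e2 : (b - α).val ≠ (α + 1 - α).val := fun e => h1 (pinj e)
            have e3 : (b - α).val ≠ (α - α).val := fun e => hb.2.2.1 (pinj e).symm
            have e4 : (α - α).val = 0 := by simp
            unfold StrictBtw
            omega
    exact ⟨b, hmem, cell_unique hm hD hC (hg b hmem).1 hb (hg b hmem).2⟩

lemma hex_lemma {C : Finset (ZMod m)} (hC : C.card = 6) {b : ZMod m} (hb : b ∈ C)
    (hodd : ∀ x y, CycConsec m C x y → (x - b).val < (y - b).val → Odd (y - x).val) :
    (C.filter fun x => Even (x - b).val).card = 3 ∧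
      ∀ a, CycConsec m C a b → Odd (a - b).val := by
  classical
  have hinj : Function.Injective (fun x : ZMod m => (x - b).val) := fun x y h => pinj h
  have hS : (C.image fun x => (x - b).val).card = 6 := by
    rw [Finset.card_image_of_injective _ hinj, hC]
  let f := (C.image fun x => (x - b).val).orderEmbOfFin hS
  have hf : ∀ i, ∃ x ∈ C, (x - b).val = f i := by
    intro i
    have := Finset.orderEmbOfFin_mem (C.image fun x => (x - b).val) hS i
    simpa using Finset.mem_image.1 this
  have hf' : ∀ z ∈ C, ∃ j, f j = (z - b).val := by
    intro z hz
    have h1 : (z - b).val ∈ Set.range f := by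
      rw [Finset.range_orderEmbOfFin]
      exact Finset.mem_coe.2 (Finset.mem_image.2 ⟨z, hz, rfl⟩)
    exact h1
  choose x hxC hx using hf
  have hcons : ∀ i j : Fin 6, j.val = i.val + 1 → f j % 2 = (f i + 1) % 2 := by
    intro i j hij
    have hlt : f i < f j := f.lt_iff_lt.2 (Fin.lt_def.2 (by omega))
    have h1 := hx i
    have h2 := hx j
    have hc : CycConsec m C (x i) (x j) := by
      refine ⟨hxC i, hxC j, ?_, ?_⟩
      · intro e
        rw [e] at h1
        omega
      · intro z hz hs
        rw [sb_base b] at hs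
        obtain ⟨k, hk⟩ := hf' z hz
        have h3 : f i < f k := by omega
        have h4 : f k < f j := by omega
        rw [f.lt_iff_lt, Fin.lt_def] at h3 h4
        omega
    have h3 := hodd _ _ hc (by omega)
    have h4 : x j - x i = (x j - b) - (x i - b) := by ring
    rw [h4, vsub, if_pos (by omega), Nat.odd_iff] at h3
    omega
  have h0 : f 0 = 0 := by
    obtain ⟨j, hj⟩ := hf' b hb
    have : f 0 ≤ f j := f.le_iff_le.2 (Fin.zero_le j)
    simp at hj
    omega
  have g1 := hcons 0 1 rfl
  have g2 := hcons 1 2 rfl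
  have g3 := hcons 2 3 rfl
  have g4 := hcons 3 4 rfl
  have g5 := hcons 4 5 rfl
  constructor
  · have hxinj : Function.Injective x := by
      intro i j h
      apply f.injective
      rw [← hx i, ← hx j, h]
    have himg : C = Finset.univ.image x := by
      ext z
      simp only [Finset.mem_image, Finset.mem_univ, true_and]
      constructor
      · intro hz
        obtain ⟨j, hj⟩ := hf' z hz
        exact ⟨j, pinj ((hx j).trans hj)⟩
      · rintro ⟨j, rfl⟩
        exact hxC j
    rw [himg, Finset.filter_image, Finset.card_image_of_injective _ hxinj]
    have : ∀ i : Fin 6, Even (x i - b).val ↔ i.val % 2 = 0 := by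
      intro i
      rw [hx, Nat.even_iff]
      fin_cases i <;> simp <;> omega
    simp only [this]
    decide
  · intro a ha
    obtain ⟨j, hj⟩ := hf' a ha.1
    have h1 := ha.2.2.2 (x 5) (hxC 5)
    rw [sb_base b, hx] at h1
    have h2 : f j ≤ f 5 := f.le_iff_le.2 (Fin.le_last j)
    have h3 : (b - b).val = 0 := by simp
    have h4 : (a - b).val ≠ (b - b).val := fun e => ha.2.2.1 (pinj e)
    rw [Nat.odd_iff]
    omega

lemma parity (hm : 3 ≤ m) (he : m % 2 = 0) {D : Set (Sym2 (ZMod m))}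
    (hD : IsPAngulation m 6 D) : ∀ N : ℕ, ∀ a b : ZMod m, s(a, b) ∈ D → (a - b).val = N → Odd N := by
  intro N
  induction N using Nat.strong_induction_on with
  | _ N ih =>
    rintro a b hab rfl
    obtain ⟨C, hC, hc⟩ := cell_exists hm hD.1 (Or.inl hab)
    refine (hex_lemma (hD.2 C hC) hc.2.1 ?_).2 a hc
    intro x y hxy hlt
    rcases hC.2.1 _ _ hxy with h | h
    · refine ih _ ?_ y x (Sym2.eq_swap ▸ h) rfl
      have h4 : y - x = (y - b) - (x - b) := by ring
      rw [h4, vsub, if_pos (by omega)]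
      have h1 := hc.2.2.2 y hxy.2.1
      rw [sb_base b] at h1
      have h3 : (b - b).val = 0 := by simp
      have h5 : (a - b).val ≠ (b - b).val := fun e => hc.2.2.1 (pinj e)
      by_contra hcon
      have e1 : (x - b).val = (b - b).val := by omega
      have e2 : (y - b).val = (a - b).val := by omega
      obtain rfl := pinj e1
      obtain rfl := pinj e2
      obtain ⟨z, hz, hz1, hz2⟩ := third hC.1 y x
      have k1 := hxy.2.2.2 z hz
      have k2 := hc.2.2.2 z hz
      have := vne hz1
      have := vne hz2
      have := vne hxy.2.2.1
      rw [sb_val] at k1 k2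
      omega
    · rcases edge_cases h with rfl | rfl
      · rw [one_val hm]; exact odd_one
      · rw [one_val' hm, Nat.odd_iff]; omega

lemma parity_cell (hm : 3 ≤ m) (he : m % 2 = 0) {D : Set (Sym2 (ZMod m))}
    (hD : IsPAngulation m 6 D) {C : Finset (ZMod m)} (hC : IsCell m D C) {b : ZMod m} (hb : b ∈ C) :
    (C.filter fun x => Even (x - b).val).card = 3 := by
  refine (hex_lemma (hD.2 C hC) hb ?_).1
  intro x y hxy hlt
  rcases hC.2.1 _ _ hxy with h | h
  · exact parity hm he hD _ y x (Sym2.eq_swap ▸ h) rfl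
  · rcases edge_cases h with rfl | rfl
    · rw [one_val hm]; exact odd_one
    · rw [one_val' hm, Nat.odd_iff]; omega

lemma black_iff (he : m % 2 = 0) {b : ZMod m} (hb : IsBlack m b) (x : ZMod m) :
    IsBlack m x ↔ Even (x - b).val := by
  unfold IsBlack at *
  rw [vsub, Nat.even_iff]
  have := ZMod.val_lt x
  have := ZMod.val_lt b
  split_ifs <;> omega

open Classical in
lemma black_card (hm : 3 ≤ m) (he : m % 2 = 0) {D : Set (Sym2 (ZMod m))}
    (hD : IsPAngulation m 6 D) {C : Finset (ZMod m)} (hC : IsCell m D C) {b : ZMod m} (hb : b ∈ C)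
    (hbb : IsBlack m b) : (C.filter fun x => IsBlack m x).card = 3 := by
  rw [← parity_cell hm he hD hC hb]
  congr 1
  ext x
  simp only [Finset.mem_filter, black_iff he hbb]

lemma black_not_D (hm : 3 ≤ m) (he : m % 2 = 0) {D : Set (Sym2 (ZMod m))}
    (hD : IsPAngulation m 6 D) {a b : ZMod m} (ha : IsBlack m a) (hb : IsBlack m b) :
    s(a, b) ∉ D := by
  intro h
  have h1 := parity hm he hD _ a b h rfl
  have h2 := (black_iff he hb a).1 ha
  exact (Nat.not_even_iff_odd.2 h1) h2

lemma mem_odd {D : Set (Sym2 (ZMod m))} {a b : ZMod m} : s(a, b) ∈ oddPairs m D ↔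
    ∃ C, IsCell m D C ∧ a ∈ C ∧ b ∈ C ∧ a ≠ b ∧ IsBlack m a ∧ IsBlack m b := by
  constructor
  · rintro ⟨C, c, d, hC, he, hc, hd, h1, h2, h3⟩
    rw [Sym2.eq_iff] at he
    rcases he with ⟨rfl, rfl⟩ | ⟨rfl, rfl⟩
    · exact ⟨C, hC, hc, hd, h1, h2, h3⟩
    · exact ⟨C, hC, hd, hc, h1.symm, h3, h2⟩
  · rintro ⟨C, hC, hc, hd, h1, h2, h3⟩
    exact ⟨C, a, b, hC, rfl, hc, hd, h1, h2, h3⟩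

lemma assoc_dissection (hm : 3 ≤ m) (he : m % 2 = 0) {D : Set (Sym2 (ZMod m))}
    (hD : IsPAngulation m 6 D) : IsDissection m (assocTriangulation m D) := by
  classical
  constructor
  · rintro e (h | h)
    · exact hD.1.1 e h
    · obtain ⟨C, a, b, hC, rfl, ha, hb, hab, h1, h2⟩ := h
      refine ⟨a, b, rfl, hab, ?_, ?_⟩
      · rintro rfl
        have := (black_iff he h1 _).1 h2
        rw [one_val hm] at this
        exact absurd this (by decide)
      · rintro rfl
        have := (black_iff he h2 _).1 h1
        rw [one_val hm] at this
        exact absurd this (by decide)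
  · rintro e h1 f h2 ⟨a, b, c, d, rfl, rfl, h3, h4⟩
    have h5 : StrictBtw m c b d := by rw [sb_val] at *; omega
    have h6 : StrictBtw m d a c := by rw [sb_val] at *; omega
    rcases h1 with h1 | h1 <;> rcases h2 with h2 | h2
    · exact no_cross hD.1 h1 h2 h3 h4
    · obtain ⟨C, hC, hc, hd, -⟩ := mem_odd.1 h2
      exact diag_cell_nocross hm hD.1 hC h1 hc hd h3 h4
    · obtain ⟨C, hC, ha, hb, -⟩ := mem_odd.1 h1
      exact diag_cell_nocross hm hD.1 hC h2 hb ha h5 h6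
    · obtain ⟨C, hC, ha, hb, hab, ba, bb⟩ := mem_odd.1 h1
      obtain ⟨C', hC', hc, hd, hcd, bc, bd⟩ := mem_odd.1 h2
      by_cases hne : C' = C
      · subst hne
        have hk := black_card hm he hD hC ha ba
        have hsub : ({a, b, c, d} : Finset (ZMod m)) ⊆ C'.filter fun x => IsBlack m x := by
          intro z hz
          simp only [Finset.mem_insert, Finset.mem_singleton] at hz
          rw [Finset.mem_filter]
          rcases hz with rfl | rfl | rfl | rfl <;> exact ⟨by assumption, by assumption⟩
        have h7 := Finset.card_le_card hsub
        have hac : a ≠ c := by rintro rfl; rw [sb_val] at *; omega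
        have had : a ≠ d := by rintro rfl; rw [sb_val] at *; omega
        have hbc : b ≠ c := by rintro rfl; rw [sb_val] at *; omega
        have hbd : b ≠ d := by rintro rfl; rw [sb_val] at *; omega
        have h8 : ({a, b, c, d} : Finset (ZMod m)).card = 4 := by
          simp [hab, hac, had, hbc, hbd, hcd]
        omega
      · exact cells_nocross hm hD.1 hC hC' hne ha hb hc hd h3 h4

lemma odd_count (hm : 3 ≤ m) (he : m % 2 = 0) {D : Set (Sym2 (ZMod m))}
    (hD : IsPAngulation m 6 D) {α : ZMod m} (hα : IsBlack m α) :
    {b | s(α, b) ∈ oddPairs m D}.ncard = 2 * cellCount m D α := by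
  classical
  let K : Finset (Finset (ZMod m)) := Finset.univ.filter fun C => IsCell m D C ∧ α ∈ C
  have hK : cellCount m D α = K.card := by
    unfold cellCount
    rw [← Set.ncard_coe_finset]
    congr 1
    ext C
    simp [K]
  have hO : {b | s(α, b) ∈ oddPairs m D} =
      ((K.biUnion fun C => (C.filter fun x => IsBlack m x).erase α : Finset (ZMod m)) :
        Set (ZMod m)) := by
    ext b
    simp only [Set.mem_setOf_eq, mem_odd, Finset.mem_coe, Finset.mem_biUnion, Finset.mem_erase,
      Finset.mem_filter, K, Finset.mem_univ, true_and]
    constructor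
    · rintro ⟨C, h1, h2, h3, h4, h5, h6⟩
      exact ⟨C, ⟨h1, h2⟩, h4.symm, h3, h6⟩
    · rintro ⟨C, ⟨h1, h2⟩, h4, h3, h6⟩
      exact ⟨C, h1, h2, h3, h4.symm, hα, h6⟩
  rw [hO, Set.ncard_coe_finset, Finset.card_biUnion, hK]
  · rw [Finset.sum_const_nat (m := 2), mul_comm]
    intro C hC
    simp only [K, Finset.mem_filter, Finset.mem_univ, true_and] at hC
    rw [Finset.card_erase_of_mem (Finset.mem_filter.2 ⟨hC.2, hα⟩),
      black_card hm he hD hC.1 hC.2 hα]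
  · intro C hC C' hC' hne
    simp only [K, Finset.mem_coe, Finset.mem_filter, Finset.mem_univ, true_and] at hC hC'
    show Disjoint _ _
    rw [Finset.disjoint_left]
    intro x hx hx'
    simp only [Finset.mem_erase, Finset.mem_filter] at hx hx'
    exact black_not_D hm he hD hα hx.2.2
      (cells_share hm hD.1 hC.1 hC'.1 hne.symm hC.2 hx.2.1 hC'.2 hx'.2.1 hx.1.symm)

end helpers

/-- For a `6`-angulation `D` of the `(4s+2)`-gon and its associated
triangulation `T_D` (triangulate every hexagon by inserting edges between all
pairs of its odd vertices), the number `t_α` of triangles of `T_D` incident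
with a vertex `α` is `q_α` for even `α` and `3 q_α` for odd `α`, where `q_α` is
the number of hexagons of `D` incident with `α`. -/
theorem stmt12 (s : ℕ) (hs : 1 ≤ s) (D : Set (Sym2 (ZMod (4 * s + 2))))
    (hD : IsPAngulation (4 * s + 2) 6 D) (α : ZMod (4 * s + 2)) :
    (¬ IsBlack (4 * s + 2) α →
      cellCount (4 * s + 2) (assocTriangulation (4 * s + 2) D) α =
        cellCount (4 * s + 2) D α) ∧
    (IsBlack (4 * s + 2) α →
      cellCount (4 * s + 2) (assocTriangulation (4 * s + 2) D) α =
        3 * cellCount (4 * s + 2) D α) := by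

  have hm : 3 ≤ 4 * s + 2 := by omega
  have he : (4 * s + 2) % 2 = 0 := by omega
  have hT := count_eq hm (assoc_dissection hm he hD) α
  have hQ := count_eq hm hD.1 α
  constructor
  · intro hα
    have : {b | s(α, b) ∈ assocTriangulation (4 * s + 2) D} = {b | s(α, b) ∈ D} := by
      ext b
      constructor
      · rintro (h | h)
        · exact h
        · obtain ⟨C, -, -, -, -, h, -⟩ := mem_odd.1 h
          exact absurd h hα
      · exact fun h => Or.inl h
    rw [hT, hQ, this]
  · intro hα
    have : {b | s(α, b) ∈ assocTriangulation (4 * s + 2) D} =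
        {b | s(α, b) ∈ D} ∪ {b | s(α, b) ∈ oddPairs (4 * s + 2) D} := rfl
    rw [this, Set.ncard_union_eq ?_ (Set.toFinite _) (Set.toFinite _),
      odd_count hm he hD hα] at hT
    · omega
    · rw [Set.disjoint_left]
      intro b hb hb'
      obtain ⟨C, -, -, -, -, -, h⟩ := mem_odd.1 hb'
      exact black_not_D hm he hD hα h hb

end FriezeNote
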